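/- Let H be a real Hilbert space, K ≥ 1, and w_1, …, w_K ≥ 0 with Σ_{k=1}^{K} w_k = 1. Let L ≥ λ > 0, and for each k let L_k : H → ℝ be differentiable with L-Lipschitz gradient and λ-strongly convex (i.e., θ ↦ L_k(θ) − (λ/2)‖θ‖² is convex), attaining its minimum value L_k^*. Let F = Σ_{k=1}^{K} w_k·L_k, let θ* be a minimizer of F, and let Γ = F(θ*) − Σ_{k=1}^{K} w_k·L_k^*. Given points θ_1, …, θ_K ∈ H, set θ̄ = Σ_k w_k·θ_k and ḡ = Σ_k w_k·∇L_k(θ_k), and let 0 < η ≤ 1/(4L). Then ‖θ̄ − η·ḡ − θ*‖² ≤ (1 − η·λ)·‖θ̄ − θ*‖² + 6·L·η²·Γ + 2·Σ_{k=1}^{K} w_k·‖θ̄ − θ_k‖². -/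

import Mathlib

section FirstOrder

variable {H : Type*} [NormedAddCommGroup H] [InnerProductSpace ℝ H]

theorem HasGradientAt.hasDerivAt_add_smul [CompleteSpace H] {f : H → ℝ} {g x v : H} {t : ℝ}
    (hf : HasGradientAt f g (x + t • v)) :
    HasDerivAt (fun s : ℝ => f (x + s • v)) (inner ℝ g v) t := by
  have hline : HasDerivAt (fun s : ℝ => x + s • v) v t := by
    simpa using ((hasDerivAt_id t).smul_const v).const_add x
  simpa using! hf.hasFDerivAt.comp_hasDerivAt t hline

/-- A function whose gradient is `L`-Lipschitz lies below its quadratic upper model. -/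
theorem le_add_inner_add_sq_of_lipschitz_gradient [CompleteSpace H] {f : H → ℝ} {f' : H → H}
    {L : ℝ} (hf : ∀ x, HasGradientAt f (f' x) x)
    (hLip : ∀ x y, ‖f' x - f' y‖ ≤ L * ‖x - y‖) (x v : H) :
    f (x + v) ≤ f x + inner ℝ (f' x) v + L / 2 * ‖v‖ ^ 2 := by
  have hline (t : ℝ) : HasDerivAt (fun s : ℝ => f (x + s • v)) (inner ℝ (f' (x + t • v)) v) t :=
    (hf _).hasDerivAt_add_smul
  have hmodel (t : ℝ) :
      HasDerivAt (fun s : ℝ => f x + s * inner ℝ (f' x) v + s ^ 2 * (L / 2 * ‖v‖ ^ 2))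
        (inner ℝ (f' x) v + t * (L * ‖v‖ ^ 2)) t := by
    convert! (((hasDerivAt_id t).mul_const (inner ℝ (f' x) v)).const_add (f x)).add
      ((hasDerivAt_pow 2 t).mul_const (L / 2 * ‖v‖ ^ 2)) using 1
    simp
    ring
  have key := image_le_of_deriv_right_le_deriv_boundary (a := 0) (b := 1)
    (fun t _ => (hline t).continuousAt.continuousWithinAt)
    (fun t _ => (hline t).hasDerivWithinAt) (by simp)
    (fun t _ => (hmodel t).continuousAt.continuousWithinAt)
    (fun t _ => (hmodel t).hasDerivWithinAt)
    (fun t ht => by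
      have hnorm := hLip (x + t • v) x
      rw [add_sub_cancel_left, norm_smul, Real.norm_of_nonneg ht.1] at hnorm
      have hinner := real_inner_le_norm (f' (x + t • v) - f' x) v
      rw [inner_sub_left] at hinner
      nlinarith [mul_le_mul_of_nonneg_right hnorm (norm_nonneg v)])
    (Set.right_mem_Icc.2 zero_le_one)
  simpa using key

/-- The squared gradient norm of a function with `L`-Lipschitz gradient is controlled by the
suboptimality gap. -/
theorem sq_norm_gradient_le_of_lipschitz [CompleteSpace H] {f : H → ℝ} {f' : H → H}
    {L c : ℝ} (hL : 0 < L) (hf : ∀ x, HasGradientAt f (f' x) x)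
    (hLip : ∀ x y, ‖f' x - f' y‖ ≤ L * ‖x - y‖) (hc : ∀ x, c ≤ f x) (x : H) :
    ‖f' x‖ ^ 2 ≤ 2 * L * (f x - c) := by
  have h := (hc _).trans (le_add_inner_add_sq_of_lipschitz_gradient hf hLip x (-L⁻¹ • f' x))
  rw [inner_smul_right, real_inner_self_eq_norm_sq, norm_smul, mul_pow, Real.norm_eq_abs,
    sq_abs] at h
  have h' : ‖f' x‖ ^ 2 / (2 * L) ≤ f x - c := by
    have : -L⁻¹ * ‖f' x‖ ^ 2 + L / 2 * ((-L⁻¹) ^ 2 * ‖f' x‖ ^ 2) = -(‖f' x‖ ^ 2 / (2 * L)) := by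
      field_simp
      ring
    linarith
  rwa [div_le_iff₀' (by positivity)] at h'

/-- First-order lower bound for strongly convex functions. -/
theorem add_inner_add_sq_le_of_strongly_convex [CompleteSpace H] {f : H → ℝ} {g x : H} {m : ℝ}
    (hf : HasGradientAt f g x)
    (hsc : ConvexOn ℝ Set.univ (fun z => f z - m / 2 * ‖z‖ ^ 2)) (y : H) :
    f x + inner ℝ g (y - x) + m / 2 * ‖y - x‖ ^ 2 ≤ f y := by
  have hline : HasDerivAt (fun s : ℝ => x + s • (y - x)) (y - x) 0 := by
    simpa using ((hasDerivAt_id (0 : ℝ)).smul_const (y - x)).const_add x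
  have hderiv := (HasGradientAt.hasDerivAt_add_smul (f := f) (g := g) (x := x) (v := y - x)
    (t := 0) (by simpa using hf)).sub (hline.norm_sq.const_mul (m / 2))
  have hconv : ConvexOn ℝ Set.univ
      ((fun s : ℝ => f (x + s • (y - x))) - fun s : ℝ => m / 2 * ‖x + s • (y - x)‖ ^ 2) := by
    convert! hsc.comp_affineMap (AffineMap.lineMap x y : ℝ →ᵃ[ℝ] H) using 1
    ext s
    simp [AffineMap.lineMap_apply, add_comm]
  have hslope := hconv.le_slope_of_hasDerivAt (Set.mem_univ 0) (Set.mem_univ 1) zero_lt_one hderiv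
  simp only [slope_def_field, Pi.sub_apply, zero_smul, add_zero, one_smul, add_sub_cancel,
    sub_zero, div_one] at hslope
  rw [norm_sub_sq_real, real_inner_comm x y]
  rw [inner_sub_right x, real_inner_self_eq_norm_sq] at hslope
  linarith

/-- Jensen's inequality for the squared norm. -/
theorem sq_norm_sum_smul_le {ι : Type*} [Fintype ι] {w : ι → ℝ} (hw : ∀ i, 0 ≤ w i)
    (hw1 : ∑ i, w i = 1) (v : ι → H) :
    ‖∑ i, w i • v i‖ ^ 2 ≤ ∑ i, w i * ‖v i‖ ^ 2 := by
  have h : ConvexOn ℝ Set.univ (fun x : H => ‖x‖ ^ 2) :=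
    convexOn_univ_norm.pow (fun _ _ => norm_nonneg _) 2
  simpa using h.map_sum_le (fun i _ => hw i) hw1 (fun i _ => Set.mem_univ (v i))

/-- One gradient step from `m` along the gradient at `x`, compared with a reference point `p`. -/
theorem sq_norm_sub_smul_gradient_sub_le [CompleteSpace H] {f : H → ℝ} {f' : H → H}
    {L lam c η : ℝ} (hL : 0 < L) (hlam : 0 ≤ lam) (hf : ∀ x, HasGradientAt f (f' x) x)
    (hLip : ∀ x y, ‖f' x - f' y‖ ≤ L * ‖x - y‖)
    (hsc : ConvexOn ℝ Set.univ (fun z => f z - lam / 2 * ‖z‖ ^ 2)) (hc : ∀ x, c ≤ f x)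
    (hη0 : 0 ≤ η) (hη : 2 * L * η ≤ 1) (m x p : H) :
    ‖m - p - η • f' x‖ ^ 2 ≤ ‖m - p‖ ^ 2 - η * lam * ‖x - p‖ ^ 2 + 6 * L * η ^ 2 * (f p - c)
      + 2 * ‖m - x‖ ^ 2 - 2 * η * (1 - 2 * L * η) * (1 - L * η) * (f m - f p) := by
  have hxp := add_inner_add_sq_le_of_strongly_convex (hf x) hsc p
  have hmx := add_inner_add_sq_le_of_strongly_convex (hf m) hsc x
  have hgx := sq_norm_gradient_le_of_lipschitz hL hf hLip hc x
  have hgm := sq_norm_gradient_le_of_lipschitz hL hf hLip hc m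
  have hyoung_x := sq_nonneg ‖(m - x) + η • f' x‖
  have hyoung_m := sq_nonneg ‖(m - x) - η • f' m‖
  have hsplit : inner ℝ (m - p) (f' x) = inner ℝ (m - x) (f' x) - inner ℝ (f' x) (p - x) := by
    rw [real_inner_comm (p - x), ← inner_sub_left, sub_sub_sub_cancel_right]
  have hswap : inner ℝ (f' m) (x - m) = -inner ℝ (m - x) (f' m) := by
    rw [real_inner_comm, ← inner_neg_left, neg_sub]
  rw [norm_add_sq_real, inner_smul_right, norm_smul, mul_pow, Real.norm_eq_abs, sq_abs] at hyoung_x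
  rw [norm_sub_sq_real, inner_smul_right, norm_smul, mul_pow, Real.norm_eq_abs, sq_abs] at hyoung_m
  rw [norm_sub_sq_real (m - p), inner_smul_right, norm_smul, mul_pow, Real.norm_eq_abs, sq_abs,
    hsplit]
  rw [norm_sub_rev p x] at hxp
  rw [hswap] at hmx
  have hβ : 0 ≤ 1 - 2 * L * η := by linarith
  have hmx' : f m - inner ℝ (m - x) (f' m) ≤ f x := by
    have : 0 ≤ lam / 2 * ‖x - m‖ ^ 2 := by positivity
    linarith
  have hdesc : 2 * η * (f m - f x) ≤ 2 * L * η ^ 2 * (f m - c) + ‖m - x‖ ^ 2 := by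
    nlinarith [mul_le_mul_of_nonneg_left hmx' hη0, mul_le_mul_of_nonneg_left hgm (sq_nonneg η)]
  have hdesc' := mul_le_mul_of_nonneg_left hdesc hβ
  have hxp' := mul_le_mul_of_nonneg_left hxp hη0
  have hgx' := mul_le_mul_of_nonneg_left hgx (sq_nonneg η)
  have hgap : 0 ≤ L * η * (L * η ^ 2 * (f p - c)) := by
    have := sub_nonneg.2 (hc p)
    positivity
  have hdist : 0 ≤ L * η * ‖m - x‖ ^ 2 := by positivity
  linarith

end FirstOrder


/-- Deterministic core of Lemma B.1 (the one-step SGD result of Theorem 3). -/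
theorem one_step_sgd_bound
    {H : Type*} [NormedAddCommGroup H] [InnerProductSpace ℝ H] [CompleteSpace H]
    (K : ℕ) (hK : 1 ≤ K)
    (w : Fin K → ℝ) (hw : ∀ k, 0 ≤ w k) (hw1 : ∑ k, w k = 1)
    (L lam : ℝ) (hlam : 0 < lam) (hLlam : lam ≤ L)
    (Lk : Fin K → H → ℝ) (gradLk : Fin K → H → H)
    (hgrad : ∀ k x, HasGradientAt (Lk k) (gradLk k x) x)
    (hLip : ∀ k x y, ‖gradLk k x - gradLk k y‖ ≤ L * ‖x - y‖)
    (hsc : ∀ k, ConvexOn ℝ Set.univ (fun θ => Lk k θ - (lam / 2) * ‖θ‖ ^ 2))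
    (Lkstar : Fin K → ℝ)
    (hattain : ∀ k, ∃ x, Lk k x = Lkstar k ∧ ∀ y, Lkstar k ≤ Lk k y)
    (θstar : H)
    (hθstar : ∀ θ, ∑ k, w k * Lk k θstar ≤ ∑ k, w k * Lk k θ)
    (Γ : ℝ) (hΓ : Γ = ∑ k, w k * Lk k θstar - ∑ k, w k * Lkstar k)
    (θ : Fin K → H)
    (θbar : H) (hθbar : θbar = ∑ k, w k • θ k)
    (gbar : H) (hgbar : gbar = ∑ k, w k • gradLk k (θ k))
    (η : ℝ) (hη0 : 0 < η) (hη : η ≤ 1 / (4 * L)) :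
    ‖θbar - η • gbar - θstar‖ ^ 2
      ≤ (1 - η * lam) * ‖θbar - θstar‖ ^ 2 + 6 * L * η ^ 2 * Γ
        + 2 * ∑ k, w k * ‖θbar - θ k‖ ^ 2 := by
  have hL : 0 < L := hlam.trans_le hLlam
  have hη' : 4 * L * η ≤ 1 := by
    rwa [le_div_iff₀' (by positivity)] at hη
  have hβ : 0 ≤ 2 * η * (1 - 2 * L * η) * (1 - L * η) := by
    have : 0 < L * η := by positivity
    exact mul_nonneg (mul_nonneg (by positivity) (by linarith)) (by linarith)
  have hsum_sub (a : H) (u : Fin K → H) : ∑ k, w k • (a - u k) = a - ∑ k, w k • u k := by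
    simp only [smul_sub, Finset.sum_sub_distrib, ← Finset.sum_smul, hw1, one_smul]
  have hstep : ‖θbar - η • gbar - θstar‖ ^ 2
      ≤ ∑ k, w k * ‖θbar - θstar - η • gradLk k (θ k)‖ ^ 2 := by
    convert sq_norm_sum_smul_le hw hw1 (fun k => θbar - θstar - η • gradLk k (θ k)) using 3
    rw [hsum_sub, hgbar, Finset.smul_sum, sub_right_comm]
    simp only [smul_comm η]
  have hdist : ‖θbar - θstar‖ ^ 2 ≤ ∑ k, w k * ‖θ k - θstar‖ ^ 2 := by
    have h := sq_norm_sum_smul_le hw hw1 (fun k => θstar - θ k)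
    rw [hsum_sub, ← hθbar] at h
    simpa only [norm_sub_rev θstar] using h
  have hclient := Finset.sum_le_sum fun k (_ : k ∈ Finset.univ) =>
    mul_le_mul_of_nonneg_left
      (sq_norm_sub_smul_gradient_sub_le hL hlam.le (hgrad k) (hLip k) (hsc k)
        (c := Lkstar k) (by obtain ⟨x, -, hx⟩ := hattain k; exact hx) hη0.le
        (by nlinarith [mul_pos hL hη0]) θbar (θ k) θstar) (hw k)
  have hexpand : ∑ k, w k * (‖θbar - θstar‖ ^ 2 - η * lam * ‖θ k - θstar‖ ^ 2
        + 6 * L * η ^ 2 * (Lk k θstar - Lkstar k) + 2 * ‖θbar - θ k‖ ^ 2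
        - 2 * η * (1 - 2 * L * η) * (1 - L * η) * (Lk k θbar - Lk k θstar))
      = ‖θbar - θstar‖ ^ 2 - η * lam * ∑ k, w k * ‖θ k - θstar‖ ^ 2 + 6 * L * η ^ 2 * Γ
        + 2 * ∑ k, w k * ‖θbar - θ k‖ ^ 2
        - 2 * η * (1 - 2 * L * η) * (1 - L * η)
          * (∑ k, w k * Lk k θbar - ∑ k, w k * Lk k θstar) := by
    have hconst : ‖θbar - θstar‖ ^ 2 = ∑ k, w k * ‖θbar - θstar‖ ^ 2 := by
      rw [← Finset.sum_mul, hw1, one_mul]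
    conv_rhs => rw [hΓ, hconst]
    simp only [← Finset.sum_sub_distrib, Finset.mul_sum, ← Finset.sum_add_distrib]
    refine Finset.sum_congr rfl fun k _ => ?_
    ring
  rw [hexpand] at hclient
  have hmin := mul_nonneg hβ (sub_nonneg.2 (hθstar θbar))
  have hdist' := mul_le_mul_of_nonneg_left hdist (mul_pos hη0 hlam).le
  linarith
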